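/- Let C = ⟨(b(x) | 0), (ℓ(x) | a(x))⟩ be a non-separable Z₂-double cyclic code with b(x) | x^r−1, a(x) | x^s−1, the subcode {(p(x) | 0) ∈ C} equal to ⟨(b(x) | 0)⟩, and a(x) generating C_s, and write C^⊥ = ⟨(b̄(x) | 0), (ℓ̄(x) | ā(x))⟩ with b̄(x) | x^r−1, ā(x) | x^s−1, {(p(x) | 0) ∈ C^⊥} = ⟨(b̄(x) | 0)⟩, and ā(x) generating (C^⊥)_s. Set ρ(x) = ℓ(x)/gcd(b(x), ℓ(x)) and 𝔪 = lcm(r,s). Then there exists λ(x) ∈ Z₂[x] such that ℓ̄(x) = ((x^r−1)/b*(x))·λ(x) in Z₂[x]/(x^r−1), and λ(x)·x^𝔪·ρ*(x) ≡ x^{𝔪 − deg a(x) + deg ℓ(x)} modulo b*(x)/gcd(b(x), ℓ(x))*; equivalently λ(x) ≡ x^{𝔪 − deg a(x) + deg ℓ(x)}·(ρ*(x))^{−1} modulo b*(x)/gcd(b(x), ℓ(x))*, where ρ*(x) is invertible modulo b*(x)/gcd(b(x), ℓ(x))*. -/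

import Mathlib

open Polynomial

noncomputable section

/-- The polynomial ring `Z₂[x]`. -/
abbrev Z2P : Type := Polynomial (ZMod 2)

/-- The quotient ring `Z₂[x]/(x^n - 1)`. -/
abbrev Rq (n : ℕ) : Type := Z2P ⧸ Ideal.span {(X : Z2P) ^ n - 1}

/-- The canonical projection `Z₂[x] → Z₂[x]/(x^n - 1)`. -/
def mkQ (n : ℕ) : Z2P →+* Rq n := Ideal.Quotient.mk _

/-- The element of `Z₂[x]/(x^n − 1)` associated to a vector `v ∈ Z₂^n` via coefficients. -/
def ofVec (n : ℕ) (v : Fin n → ZMod 2) : Rq n :=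
  mkQ n (∑ i : Fin n, Polynomial.C (v i) * (X : Z2P) ^ (i : ℕ))

/-- The dual code `C^⊥` of a `Z₂`-double cyclic code `C ⊆ R_{r,s}`, computed with respect to
the standard inner product on `Z₂^{r+s}` under the coefficient identification
`R_{r,s} ≅ Z₂^r × Z₂^s`. -/
def dualCode (r s : ℕ) (C : Submodule Z2P (Rq r × Rq s)) : Set (Rq r × Rq s) :=
  {c | ∃ w : (Fin r → ZMod 2) × (Fin s → ZMod 2),
        (ofVec r w.1, ofVec s w.2) = c ∧
        ∀ u : (Fin r → ZMod 2) × (Fin s → ZMod 2),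
          (ofVec r u.1, ofVec s u.2) ∈ C →
          (∑ i, u.1 i * w.1 i) + (∑ j, u.2 j * w.2 j) = 0}

/-- The sum of the coefficients of a Laurent polynomial at exponents divisible by `n`. -/
def periodicTrace (n : ℕ) : LaurentPolynomial (ZMod 2) →+ ZMod 2 where
  toFun f := (AddMonoidAlgebra.mapDomain (fun k : ℤ => (k : ZMod n)) f).coeff 0
  map_zero' := by simp
  map_add' f g := by simp [AddMonoidAlgebra.mapDomain_add]

open LaurentPolynomial in
lemma periodicTrace_C_mul_T (n : ℕ) (c : ZMod 2) (k : ℤ) :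
    periodicTrace n (LaurentPolynomial.C c * T k) = if (n : ℤ) ∣ k then c else 0 := by
  rw [← single_eq_C_mul_T]
  simp only [periodicTrace, AddMonoidHom.coe_mk, ZeroHom.coe_mk,
    AddMonoidAlgebra.mapDomain_single, AddMonoidAlgebra.coeff_single, Finsupp.single_apply,
    ZMod.intCast_zmod_eq_zero_iff_dvd]

open LaurentPolynomial in
lemma T_sub_one_dvd_T_sub_one {R : Type*} [CommRing R] (n : ℕ) {k : ℤ} (h : (n : ℤ) ∣ k) :
    (T n - 1 : LaurentPolynomial R) ∣ T k - 1 := by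
  have key (j : ℕ) : (T n - 1 : LaurentPolynomial R) ∣ T ((n : ℤ) * j) - 1 := by
    have := sub_one_dvd_pow_sub_one (T (n : ℤ) : LaurentPolynomial R) j
    rwa [T_pow, mul_comm] at this
  obtain ⟨q, rfl⟩ := h
  obtain ⟨j, rfl | rfl⟩ := q.eq_nat_or_neg
  · exact key j
  · have : (T ((n : ℤ) * -j) - 1 : LaurentPolynomial R) =
        -T ((n : ℤ) * -j) * (T ((n : ℤ) * j) - 1) := by
      rw [mul_sub, neg_mul, ← T_add]
      simp
      ring
    rw [this]
    exact (key j).mul_left _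

open LaurentPolynomial in
lemma periodicTrace_eq_zero_of_dvd {n : ℕ} {f : LaurentPolynomial (ZMod 2)}
    (h : (T n - 1 : LaurentPolynomial (ZMod 2)) ∣ f) : periodicTrace n f = 0 := by
  obtain ⟨q, rfl⟩ := h
  induction q using LaurentPolynomial.induction_on' with
  | add p q hp hq => rw [mul_add, map_add, hp, hq, add_zero]
  | C_mul_T k c =>
    have : (T n - 1) * (LaurentPolynomial.C c * T k) =
        LaurentPolynomial.C c * T (n + k) - LaurentPolynomial.C c * T k := by
      rw [T_add]; ring
    rw [this, map_sub, periodicTrace_C_mul_T, periodicTrace_C_mul_T]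
    simp

open LaurentPolynomial in
lemma T_sub_one_dvd_of_periodicTrace {n : ℕ} (hn : 0 < n) {f : LaurentPolynomial (ZMod 2)}
    (h : ∀ j : ℕ, periodicTrace n (T j * f) = 0) :
    (T n - 1 : LaurentPolynomial (ZMod 2)) ∣ f := by
  have key (f : LaurentPolynomial (ZMod 2)) : (T n - 1 : LaurentPolynomial (ZMod 2)) ∣
      f - ∑ j ∈ Finset.range n, LaurentPolynomial.C (periodicTrace n (T j * f)) * T (-j) := by
    induction f using LaurentPolynomial.induction_on' with
    | add p q hp hq =>
      convert dvd_add hp hq using 1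
      simp only [mul_add, map_add, add_mul, Finset.sum_add_distrib]
      ring
    | C_mul_T k c =>
      have hn' : (0 : ℤ) < n := by exact_mod_cast hn
      have h0 := Int.emod_nonneg (-k) hn'.ne'
      have h1 := Int.emod_lt_of_pos (-k) hn'
      have h2 : ((n : ℤ) ∣ ((-k) % n) + k) :=
        ⟨-((-k) / n), by linarith [Int.emod_add_mul_ediv (-k) n]⟩
      rw [Finset.sum_eq_single ((-k) % n).toNat]
      · rw [Int.toNat_of_nonneg h0]
        have : T ((-k) % n) * (LaurentPolynomial.C c * T k) =
            LaurentPolynomial.C c * T ((-k) % n + k) := by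
          rw [T_add]; ring
        rw [this, periodicTrace_C_mul_T, if_pos h2, ← mul_sub]
        have : (T k - T (-((-k) % n)) : LaurentPolynomial (ZMod 2)) =
            T (-((-k) % n)) * (T ((-k) % n + k) - 1) := by
          rw [mul_sub, ← T_add]; simp
        rw [this]
        exact ((T_sub_one_dvd_T_sub_one n h2).mul_left _).mul_left _
      · intro j hj hne
        have : T j * (LaurentPolynomial.C c * T k) =
            LaurentPolynomial.C c * T (j + k) := by
          rw [T_add]; ring
        rw [this, periodicTrace_C_mul_T, if_neg, map_zero, zero_mul]
        intro hd
        apply hne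
        have hjn := Finset.mem_range.mp hj
        have h3 : (n : ℤ) ∣ j - (-k) % n := by simpa using dvd_sub hd h2
        have := Int.eq_zero_of_abs_lt_dvd h3 (by rw [abs_lt]; omega)
        omega
      · intro hnot
        exact absurd (Finset.mem_range.mpr (by omega)) hnot
  simpa only [h, map_zero, zero_mul, Finset.sum_const_zero, sub_zero] using key f

open LaurentPolynomial in
lemma periodicTrace_geom_sum_mul {n M : ℕ} (hn : 0 < n) (hM : 0 < M)
    (f : LaurentPolynomial (ZMod 2)) :
    periodicTrace (n * M) ((∑ i ∈ Finset.range M, T ((n : ℤ) * i)) * f) = periodicTrace n f := by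
  induction f using LaurentPolynomial.induction_on' with
  | add p q hp hq => rw [mul_add, map_add, map_add, hp, hq]
  | C_mul_T k c =>
    have hn' : (n : ℤ) ≠ 0 := by exact_mod_cast hn.ne'
    have hM' : (0 : ℤ) < M := by exact_mod_cast hM
    have hterm (i : ℕ) : periodicTrace (n * M) (T ((n : ℤ) * i) * (LaurentPolynomial.C c * T k)) =
        if ((n * M : ℕ) : ℤ) ∣ n * i + k then c else 0 := by
      rw [← periodicTrace_C_mul_T, T_add]
      congr 1
      ring
    rw [Finset.sum_mul, map_sum, periodicTrace_C_mul_T]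
    simp only [hterm]
    push_cast
    split_ifs with hk
    · obtain ⟨q, rfl⟩ := hk
      have h0 := Int.emod_nonneg (-q) hM'.ne'
      have h1 := Int.emod_lt_of_pos (-q) hM'
      have h2 : ((M : ℤ) ∣ ((-q) % M) + q) :=
        ⟨-((-q) / M), by linarith [Int.emod_add_mul_ediv (-q) M]⟩
      simp only [← mul_add, mul_dvd_mul_iff_left hn']
      rw [Finset.sum_eq_single ((-q) % M).toNat]
      · rw [Int.toNat_of_nonneg h0, if_pos h2]
      · intro j hj hne
        rw [if_neg]
        intro hd
        apply hne
        have hjn := Finset.mem_range.mp hj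
        have h3 : (M : ℤ) ∣ j - (-q) % M := by simpa using dvd_sub hd h2
        have := Int.eq_zero_of_abs_lt_dvd h3 (by rw [abs_lt]; omega)
        omega
      · intro hnot
        exact absurd (Finset.mem_range.mpr (by omega)) hnot
    · refine Finset.sum_eq_zero fun i _ => if_neg fun hd => hk ?_
      exact (dvd_add_right (dvd_mul_right _ _)).mp ((dvd_mul_right _ _).trans hd)

lemma mkQ_eq_mkQ_iff {n : ℕ} {f g : Z2P} : mkQ n f = mkQ n g ↔ (X : Z2P) ^ n - 1 ∣ f - g := by
  rw [mkQ, Ideal.Quotient.eq, Ideal.mem_span_singleton]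

lemma mkQ_eq_zero_iff {n : ℕ} {f : Z2P} : mkQ n f = 0 ↔ (X : Z2P) ^ n - 1 ∣ f := by
  rw [← map_zero (mkQ n), mkQ_eq_mkQ_iff, sub_zero]

lemma smul_mkQ (n : ℕ) (f g : Z2P) : f • mkQ n g = mkQ n (f * g) := rfl

lemma exists_ofVec_eq {n : ℕ} (hn : 0 < n) (f : Z2P) : ∃ v, ofVec n v = mkQ n f := by
  have hmonic : ((X : Z2P) ^ n - 1).Monic := monic_X_pow_sub_C 1 hn.ne'
  have hnat : ((X : Z2P) ^ n - 1).natDegree = n := natDegree_X_pow_sub_C (r := (1 : ZMod 2))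
  have hdeg : (f %ₘ ((X : Z2P) ^ n - 1)).natDegree < n := by
    refine (natDegree_modByMonic_lt f hmonic fun h => ?_).trans_eq hnat
    rw [h, natDegree_one] at hnat
    omega
  refine ⟨fun i => (f %ₘ ((X : Z2P) ^ n - 1)).coeff i, ?_⟩
  rw [ofVec, mkQ_eq_mkQ_iff, Fin.sum_univ_eq_sum_range
    (fun i => Polynomial.C ((f %ₘ ((X : Z2P) ^ n - 1)).coeff i) * (X : Z2P) ^ i),
    ← as_sum_range_C_mul_X_pow' _ hdeg, ← dvd_neg, neg_sub]
  exact ⟨f /ₘ ((X : Z2P) ^ n - 1), by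
    rw [sub_eq_iff_eq_add, add_comm, modByMonic_add_div]⟩

lemma toLaurent_X_pow_sub_one (n : ℕ) :
    toLaurent ((X : Z2P) ^ n - 1) = LaurentPolynomial.T n - 1 := by
  simp

lemma periodicTrace_mul_congr {n : ℕ} {f g p q : Z2P} (hf : mkQ n f = mkQ n g)
    (hp : mkQ n p = mkQ n q) :
    periodicTrace n (toLaurent f * LaurentPolynomial.invert (toLaurent p)) =
      periodicTrace n (toLaurent g * LaurentPolynomial.invert (toLaurent q)) := by
  have h1 : (LaurentPolynomial.T n - 1 : LaurentPolynomial (ZMod 2)) ∣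
      toLaurent f - toLaurent g := by
    rw [← toLaurent_X_pow_sub_one, ← map_sub]
    exact map_dvd _ (mkQ_eq_mkQ_iff.mp hf)
  have h2 : (LaurentPolynomial.T n - 1 : LaurentPolynomial (ZMod 2)) ∣
      LaurentPolynomial.invert (toLaurent p) - LaurentPolynomial.invert (toLaurent q) := by
    have := map_dvd LaurentPolynomial.invert (map_dvd toLaurent (mkQ_eq_mkQ_iff.mp hp))
    rw [toLaurent_X_pow_sub_one, map_sub, map_sub, map_sub, map_one,
      LaurentPolynomial.invert_T] at this
    exact (T_sub_one_dvd_T_sub_one n (by simp)).trans this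
  rw [← sub_eq_zero, ← map_sub]
  apply periodicTrace_eq_zero_of_dvd
  convert dvd_add (h1.mul_right (LaurentPolynomial.invert (toLaurent p)))
    (h2.mul_left (toLaurent g)) using 1
  ring

lemma periodicTrace_vec_mul_invert_vec (n : ℕ) (u w : Fin n → ZMod 2) :
    periodicTrace n (toLaurent (∑ i : Fin n, Polynomial.C (u i) * (X : Z2P) ^ (i : ℕ)) *
      LaurentPolynomial.invert
        (toLaurent (∑ i : Fin n, Polynomial.C (w i) * (X : Z2P) ^ (i : ℕ)))) =
      ∑ i, u i * w i := by
  simp only [map_sum, toLaurent_C_mul_X_pow, Finset.sum_mul_sum, map_mul LaurentPolynomial.invert,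
    LaurentPolynomial.invert_C, LaurentPolynomial.invert_T]
  refine Finset.sum_congr rfl fun i _ => ?_
  have hterm (j : Fin n) : periodicTrace n (LaurentPolynomial.C (u i) * LaurentPolynomial.T i *
      (LaurentPolynomial.C (w j) * LaurentPolynomial.T (-(j : ℤ)))) =
      if j = i then u i * w j else 0 := by
    rw [mul_mul_mul_comm, ← map_mul, ← LaurentPolynomial.T_add, periodicTrace_C_mul_T]
    refine if_congr ⟨fun h => ?_, fun h => by simp [h]⟩ rfl rfl
    have := Int.eq_zero_of_abs_lt_dvd h (by rw [abs_lt]; omega)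
    omega
  simp [hterm]

lemma mkQ_pair_mem_dualCode_iff_periodicTrace {r s : ℕ} (hr : 0 < r) (hs : 0 < s)
    (C : Submodule Z2P (Rq r × Rq s)) (w₁ w₂ : Z2P) :
    (mkQ r w₁, mkQ s w₂) ∈ dualCode r s C ↔ ∀ p q : Z2P, (mkQ r p, mkQ s q) ∈ C →
      periodicTrace r (toLaurent p * LaurentPolynomial.invert (toLaurent w₁)) +
        periodicTrace s (toLaurent q * LaurentPolynomial.invert (toLaurent w₂)) = 0 := by
  constructor
  · rintro ⟨⟨v₁, v₂⟩, hv, h⟩ p q hpq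
    obtain ⟨u₁, hu₁⟩ := exists_ofVec_eq hr p
    obtain ⟨u₂, hu₂⟩ := exists_ofVec_eq hs q
    have := h (u₁, u₂) (by rwa [hu₁, hu₂])
    rw [← periodicTrace_vec_mul_invert_vec, ← periodicTrace_vec_mul_invert_vec] at this
    rwa [periodicTrace_mul_congr hu₁ (congrArg Prod.fst hv),
      periodicTrace_mul_congr hu₂ (congrArg Prod.snd hv)] at this
  · intro h
    obtain ⟨v₁, hv₁⟩ := exists_ofVec_eq hr w₁
    obtain ⟨v₂, hv₂⟩ := exists_ofVec_eq hs w₂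
    refine ⟨(v₁, v₂), by rw [hv₁, hv₂], fun u hu => ?_⟩
    rw [← periodicTrace_vec_mul_invert_vec, ← periodicTrace_vec_mul_invert_vec,
      periodicTrace_mul_congr rfl hv₁, periodicTrace_mul_congr rfl hv₂]
    exact h _ _ hu

/-- The polynomial form of orthogonality to `⟨(b | 0), (l | a)⟩`. -/
lemma mkQ_pair_mem_dualCode_span_iff {r s M N : ℕ} (hr : 0 < r) (hs : 0 < s)
    (hM : 0 < M) (hN : 0 < N) (hMN : r * M = s * N) (b l a w₁ w₂ : Z2P) :
    (mkQ r w₁, mkQ s w₂) ∈ dualCode r s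
        (Submodule.span Z2P {((mkQ r b, 0) : Rq r × Rq s), (mkQ r l, mkQ s a)}) ↔
      LaurentPolynomial.T r - 1 ∣ toLaurent b * LaurentPolynomial.invert (toLaurent w₁) ∧
      LaurentPolynomial.T (r * M : ℕ) - 1 ∣
        (∑ i ∈ Finset.range M, LaurentPolynomial.T ((r : ℤ) * i)) *
            (toLaurent l * LaurentPolynomial.invert (toLaurent w₁)) +
          (∑ i ∈ Finset.range N, LaurentPolynomial.T ((s : ℤ) * i)) *
            (toLaurent a * LaurentPolynomial.invert (toLaurent w₂)) := by
  have key (g : LaurentPolynomial (ZMod 2)) :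
      periodicTrace r (g * toLaurent l * LaurentPolynomial.invert (toLaurent w₁)) +
        periodicTrace s (g * toLaurent a * LaurentPolynomial.invert (toLaurent w₂)) =
      periodicTrace (r * M) (g * ((∑ i ∈ Finset.range M, LaurentPolynomial.T ((r : ℤ) * i)) *
            (toLaurent l * LaurentPolynomial.invert (toLaurent w₁)) +
          (∑ i ∈ Finset.range N, LaurentPolynomial.T ((s : ℤ) * i)) *
            (toLaurent a * LaurentPolynomial.invert (toLaurent w₂)))) := by
    rw [← periodicTrace_geom_sum_mul hr hM, ← periodicTrace_geom_sum_mul hs hN, ← hMN, ← map_add]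
    congr 1
    ring
  rw [mkQ_pair_mem_dualCode_iff_periodicTrace hr hs]
  simp only [Submodule.mem_span_pair]
  constructor
  · intro h
    constructor
    · refine T_sub_one_dvd_of_periodicTrace hr fun j => ?_
      have := h (X ^ j * b) 0 ⟨X ^ j, 0, by simp [smul_mkQ]⟩
      simpa [mul_assoc] using this
    · refine T_sub_one_dvd_of_periodicTrace (Nat.mul_pos hr hM) fun j => ?_
      have := h (X ^ j * l) (X ^ j * a) ⟨0, X ^ j, by simp [smul_mkQ]⟩
      rwa [map_mul toLaurent, map_mul toLaurent, toLaurent_X_pow, key] at this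
  · rintro ⟨h₁, h₂⟩ p q ⟨f, g, hfg⟩
    have hp : mkQ r p = mkQ r (f * b + g * l) := by
      simpa [smul_mkQ] using (congrArg Prod.fst hfg).symm
    have hq : mkQ s q = mkQ s (g * a) := by
      simpa [smul_mkQ] using (congrArg Prod.snd hfg).symm
    rw [periodicTrace_mul_congr hp rfl, periodicTrace_mul_congr hq rfl, map_add toLaurent,
      map_mul toLaurent, map_mul toLaurent, map_mul toLaurent, add_mul, map_add,
      add_assoc, key, periodicTrace_eq_zero_of_dvd (h₂.mul_left _),
      mul_assoc, periodicTrace_eq_zero_of_dvd (h₁.mul_left _), add_zero]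

lemma invert_toLaurent_reverse {R : Type*} [CommSemiring R] (f : R[X]) :
    LaurentPolynomial.invert (toLaurent f.reverse) =
      toLaurent f * LaurentPolynomial.T (-(f.natDegree : ℤ)) := by
  rw [LaurentPolynomial.toLaurent_reverse, map_mul, LaurentPolynomial.invert_T,
    LaurentPolynomial.involutive_invert]

lemma invert_toLaurent {R : Type*} [CommSemiring R] (f : R[X]) :
    LaurentPolynomial.invert (toLaurent f) =
      toLaurent f.reverse * LaurentPolynomial.T (-(f.natDegree : ℤ)) := by
  rw [LaurentPolynomial.toLaurent_reverse, mul_assoc, ← LaurentPolynomial.T_add, add_neg_cancel,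
    LaurentPolynomial.T_zero, mul_one]

lemma toLaurent_reverse_dvd_iff {R : Type*} [CommSemiring R] (f : R[X])
    (z : LaurentPolynomial R) :
    toLaurent f.reverse ∣ z ↔ LaurentPolynomial.invert (toLaurent f) ∣ z := by
  rw [LaurentPolynomial.toLaurent_reverse, (LaurentPolynomial.isUnit_T _).mul_right_dvd]

lemma invert_dvd_iff {R : Type*} [CommSemiring R] (y z : LaurentPolynomial R) :
    LaurentPolynomial.invert y ∣ z ↔ y ∣ LaurentPolynomial.invert z := by
  rw [← map_dvd_iff LaurentPolynomial.invert, LaurentPolynomial.involutive_invert]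

lemma dvd_of_toLaurent_dvd_toLaurent {R : Type*} [CommRing R] {f g : R[X]} (hf : IsCoprime f X)
    (h : toLaurent f ∣ toLaurent g) : f ∣ g := by
  obtain ⟨q, hq⟩ := h
  obtain ⟨n, q', hq'⟩ := q.exists_T_pow
  have : g * X ^ n = f * q' := toLaurent_injective (by
    rw [map_mul, map_mul, hq', hq, toLaurent_X_pow, mul_assoc])
  exact (hf.pow_right (n := n)).dvd_of_dvd_mul_right ⟨q', this⟩

lemma isCoprime_X_of_dvd_X_pow_sub_one {R : Type*} [CommRing R] {n : ℕ} (hn : 0 < n) {f : R[X]}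
    (h : f ∣ X ^ n - 1) : IsCoprime f X := by
  refine IsCoprime.of_isCoprime_of_dvd_left ⟨-1, X ^ (n - 1), ?_⟩ h
  rw [← pow_succ, Nat.sub_add_cancel hn]
  ring

lemma LaurentPolynomial.zmod_two_neg_one : (-1 : LaurentPolynomial (ZMod 2)) = 1 := by
  rw [← map_one LaurentPolynomial.C, ← map_neg]
  rfl

lemma reverse_X_pow_sub_one {n : ℕ} : ((X : Z2P) ^ n - 1).reverse = X ^ n - 1 := by
  have hnat : ((X : Z2P) ^ n - 1).natDegree = n := natDegree_X_pow_sub_C (r := (1 : ZMod 2))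
  apply toLaurent_injective
  rw [LaurentPolynomial.toLaurent_reverse, hnat, toLaurent_X_pow_sub_one, map_sub, map_one,
    LaurentPolynomial.invert_T, sub_mul, ← LaurentPolynomial.T_add,
    neg_add_cancel, LaurentPolynomial.T_zero]
  linear_combination (LaurentPolynomial.T n - 1) * LaurentPolynomial.zmod_two_neg_one

lemma isCoprime_reverse {K : Type*} [Field K] {f g : K[X]} (h : IsCoprime f g)
    (hf : IsCoprime f.reverse X) : IsCoprime f.reverse g.reverse := by
  obtain ⟨c, d, hcd⟩ := h
  have h1 : LaurentPolynomial.invert (toLaurent (c * f + d * g)) = 1 := by simp [hcd]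
  simp only [map_add, map_mul, invert_toLaurent] at h1
  have h2 : X ^ (d.natDegree + g.natDegree) * c.reverse * f.reverse +
      X ^ (c.natDegree + f.natDegree) * d.reverse * g.reverse =
        (X : K[X]) ^ (c.natDegree + f.natDegree + (d.natDegree + g.natDegree)) := by
    apply toLaurent_injective
    simp only [map_add, map_mul, toLaurent_X_pow]
    push_cast
    simp only [LaurentPolynomial.T_add]
    have hT (m : ℤ) :
        (LaurentPolynomial.T m * LaurentPolynomial.T (-m) : LaurentPolynomial K) = 1 := by
      rw [← LaurentPolynomial.T_add, add_neg_cancel, LaurentPolynomial.T_zero]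
    have hc := hT c.natDegree
    have hd := hT d.natDegree
    have hf' := hT f.natDegree
    have hg := hT g.natDegree
    generalize (LaurentPolynomial.T (c.natDegree : ℤ) : LaurentPolynomial K) = tc at *
    generalize (LaurentPolynomial.T (d.natDegree : ℤ) : LaurentPolynomial K) = td at *
    generalize (LaurentPolynomial.T (f.natDegree : ℤ) : LaurentPolynomial K) = tf at *
    generalize (LaurentPolynomial.T (g.natDegree : ℤ) : LaurentPolynomial K) = tg at *
    linear_combination tc * tf * td * tg * h1 -
      td * tg * toLaurent c.reverse * toLaurent f.reverse *
        (tf * LaurentPolynomial.T (-(f.natDegree : ℤ)) * hc + hf') -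
      tc * tf * toLaurent d.reverse * toLaurent g.reverse *
        (tg * LaurentPolynomial.T (-(g.natDegree : ℤ)) * hd + hg)
  have h3 := hf.pow_right (n := c.natDegree + f.natDegree + (d.natDegree + g.natDegree))
  rw [← h2] at h3
  exact (IsCoprime.add_mul_right_right_iff.mp (by rwa [add_comm] at h3)).of_mul_right_right

lemma zmod_two_eq_of_dvd_dvd {f g : Z2P} (h : f ∣ g) (h' : g ∣ f) : f = g := by
  have hmonic {p : Z2P} (hp : p ≠ 0) : p.Monic := by
    have : ∀ c : ZMod 2, c ≠ 0 → c = 1 := by decide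
    exact this _ (leadingCoeff_ne_zero.mpr hp)
  by_cases hf : f = 0
  · subst hf
    exact (zero_dvd_iff.mp h).symm
  · exact eq_of_monic_of_associated (hmonic hf) (hmonic (ne_zero_of_dvd_ne_zero hf h'))
      (associated_of_dvd_dvd h h')

lemma geom_sum_T_mul (n M : ℕ) :
    (∑ i ∈ Finset.range M, LaurentPolynomial.T ((n : ℤ) * i)) * (LaurentPolynomial.T n - 1) =
      (LaurentPolynomial.T (n * M : ℕ) - 1 : LaurentPolynomial (ZMod 2)) := by
  have h := geom_sum_mul (LaurentPolynomial.T (n : ℤ) : LaurentPolynomial (ZMod 2)) M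
  simp only [LaurentPolynomial.T_pow] at h
  push_cast
  simpa only [mul_comm (n : ℤ)] using h

/-- Orthogonality to `⟨(g β | 0), (g ρ | a)⟩` of a pair whose first component is a multiple of the
reciprocal of `(x^r - 1) / (g β)`. -/
lemma mkQ_reverse_mul_mem_dualCode_iff {r s M N : ℕ} (hr : 0 < r) (hs : 0 < s)
    (hM : 0 < M) (hN : 0 < N) (hMN : r * M = s * N) {g β ρ a bc k : Z2P}
    (hbc : (X : Z2P) ^ r - 1 = g * β * bc) (hk : (X : Z2P) ^ s - 1 = a * (β * k)) (μ w : Z2P) :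
    (mkQ r (bc.reverse * μ), mkQ s w) ∈ dualCode r s
        (Submodule.span Z2P {((mkQ r (g * β), 0) : Rq r × Rq s), (mkQ r (g * ρ), mkQ s a)}) ↔
      toLaurent k * toLaurent β ∣
        toLaurent k * (toLaurent ρ * LaurentPolynomial.T (-(bc.natDegree : ℤ)) *
          LaurentPolynomial.invert (toLaurent μ)) +
        LaurentPolynomial.invert (toLaurent w) := by
  have hbc' := congrArg toLaurent hbc
  have hk' := congrArg toLaurent hk
  rw [toLaurent_X_pow_sub_one] at hbc' hk'
  simp only [map_mul toLaurent] at hbc' hk'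
  have h1 := geom_sum_T_mul r M
  have h2 := geom_sum_T_mul s N
  have hne : (LaurentPolynomial.T (r * M : ℕ) - 1 : LaurentPolynomial (ZMod 2)) ≠ 0 := by
    rw [← toLaurent_X_pow_sub_one, toLaurent_ne_zero]
    exact (monic_X_pow_sub_C (1 : ZMod 2) (Nat.mul_pos hr hM).ne').ne_zero
  rw [mkQ_pair_mem_dualCode_span_iff hr hs hM hN hMN]
  rw [← hMN] at h2
  simp only [map_mul, invert_toLaurent_reverse]
  rw [hbc'] at h1 ⊢
  rw [hk'] at h2
  generalize (∑ i ∈ Finset.range M, LaurentPolynomial.T ((r : ℤ) * i) :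
    LaurentPolynomial (ZMod 2)) = Θr at *
  generalize (∑ i ∈ Finset.range N, LaurentPolynomial.T ((s : ℤ) * i) :
    LaurentPolynomial (ZMod 2)) = Θs at *
  have hβ : toLaurent β ≠ 0 := by
    intro h
    rw [h] at h1
    exact hne (by rw [← h1]; ring)
  have hθ : Θs * toLaurent a ≠ 0 := by
    intro h
    exact hne (by rw [← h2, ← mul_assoc, h, zero_mul])
  have hP : Θr * toLaurent g * toLaurent bc = Θs * toLaurent a * toLaurent k := by
    apply mul_right_cancel₀ hβ
    linear_combination h1 - h2
  rw [and_iff_right ⟨LaurentPolynomial.T (-(bc.natDegree : ℤ)) *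
    LaurentPolynomial.invert (toLaurent μ), by ring⟩, ← h2,
    ← mul_dvd_mul_iff_left (b := toLaurent k * toLaurent β) hθ]
  apply iff_of_eq
  congr 1
  · ring
  · linear_combination toLaurent ρ * LaurentPolynomial.T (-(bc.natDegree : ℤ)) *
      LaurentPolynomial.invert (toLaurent μ) * hP

lemma exists_mkQ_X_pow_mul_reverse_mem_dualCode {r s M N : ℕ} (hr : 0 < r) (hs : 0 < s)
    (hM : 0 < M) (hN : 0 < N) (hMN : r * M = s * N) {g β ρ a bc k : Z2P}
    (hbc : (X : Z2P) ^ r - 1 = g * β * bc) (hk : (X : Z2P) ^ s - 1 = a * (β * k))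
    (hcop : IsCoprime β ρ) :
    ∃ (p : Rq r) (j : ℕ), (p, mkQ s (X ^ j * k.reverse)) ∈ dualCode r s
        (Submodule.span Z2P {((mkQ r (g * β), 0) : Rq r × Rq s), (mkQ r (g * ρ), mkQ s a)}) := by
  obtain ⟨d, c, hcd⟩ := hcop
  refine ⟨mkQ r (bc.reverse * (-X ^ k.natDegree * c.reverse)), bc.natDegree + c.natDegree, ?_⟩
  rw [mkQ_reverse_mul_mem_dualCode_iff hr hs hM hN hMN hbc hk]
  simp only [map_mul, map_neg, invert_toLaurent_reverse, toLaurent_X_pow,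
    LaurentPolynomial.invert_T]
  have hcd' := congrArg toLaurent hcd
  simp only [map_add, map_mul, map_one] at hcd'
  refine ⟨LaurentPolynomial.T (-(bc.natDegree : ℤ)) * LaurentPolynomial.T (-(c.natDegree : ℤ)) *
    LaurentPolynomial.T (-(k.natDegree : ℤ)) * toLaurent d, ?_⟩
  push_cast
  rw [neg_add, LaurentPolynomial.T_add]
  linear_combination -(LaurentPolynomial.T (-(bc.natDegree : ℤ)) *
    LaurentPolynomial.T (-(c.natDegree : ℤ)) * LaurentPolynomial.T (-(k.natDegree : ℤ)) *
    toLaurent k) * hcd'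

lemma reverse_dvd_X_pow_sub_one {n : ℕ} {f : Z2P} (h : f ∣ X ^ n - 1) :
    f.reverse ∣ X ^ n - 1 := by
  obtain ⟨q, hq⟩ := h
  rw [← reverse_X_pow_sub_one, hq, reverse_mul_of_domain]
  exact dvd_mul_right _ _

lemma reverse_dvd_of_mkQ_mem_dualCode {r s M N : ℕ} (hr : 0 < r) (hs : 0 < s)
    (hM : 0 < M) (hN : 0 < N) (hMN : r * M = s * N) {g β ρ a bc k : Z2P}
    (hg : g ≠ 0) (hρ : ρ ≠ 0)
    (hbc : (X : Z2P) ^ r - 1 = g * β * bc) (hk : (X : Z2P) ^ s - 1 = a * (β * k)) (μ : Z2P)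
    (hmem : (mkQ r (bc.reverse * μ), mkQ s k.reverse) ∈ dualCode r s
      (Submodule.span Z2P {((mkQ r (g * β), 0) : Rq r × Rq s), (mkQ r (g * ρ), mkQ s a)})) :
    β.reverse ∣ μ * X ^ (r * M) * ρ.reverse -
      X ^ (r * M - a.natDegree + (g * ρ).natDegree) := by
  have hr0 : (X : Z2P) ^ r - 1 ≠ 0 := (monic_X_pow_sub_C (1 : ZMod 2) hr.ne').ne_zero
  have hs0 : (X : Z2P) ^ s - 1 ≠ 0 := (monic_X_pow_sub_C (1 : ZMod 2) hs.ne').ne_zero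
  have hβbc : β ≠ 0 ∧ bc ≠ 0 := by
    constructor <;> (rintro rfl; simp at hbc; exact hr0 hbc)
  have hak : a ≠ 0 ∧ k ≠ 0 := by
    constructor <;> (rintro rfl; simp at hk; exact hs0 hk)
  have hdr : r = g.natDegree + β.natDegree + bc.natDegree := by
    rw [← natDegree_mul hg hβbc.1, ← natDegree_mul (mul_ne_zero hg hβbc.1) hβbc.2, ← hbc]
    exact (natDegree_X_pow_sub_C (r := (1 : ZMod 2))).symm
  have hds : s = a.natDegree + (β.natDegree + k.natDegree) := by
    rw [← natDegree_mul hβbc.1 hak.2, ← natDegree_mul hak.1 (mul_ne_zero hβbc.1 hak.2), ← hk]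
    exact (natDegree_X_pow_sub_C (r := (1 : ZMod 2))).symm
  have hβr : β ∣ X ^ r - 1 := ⟨g * bc, by rw [hbc]; ring⟩
  have hβs : β ∣ X ^ s - 1 := ⟨a * k, by rw [hk]; ring⟩
  have hTr := map_dvd toLaurent (reverse_dvd_X_pow_sub_one hβr)
  have hTs := map_dvd toLaurent (reverse_dvd_X_pow_sub_one hβs)
  rw [toLaurent_X_pow_sub_one] at hTr hTs
  have hTm := hTr.trans (T_sub_one_dvd_T_sub_one r (k := (r * M : ℕ)) (by push_cast; simp))
  have hle : a.natDegree ≤ r * M := by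
    rw [hMN]
    exact (show a.natDegree ≤ s by omega).trans (Nat.le_mul_of_pos_right s hN)
  rw [mkQ_reverse_mul_mem_dualCode_iff hr hs hM hN hMN hbc hk, invert_toLaurent_reverse,
    ← mul_add, mul_dvd_mul_iff_left (toLaurent_ne_zero.mpr hak.2),
    ← map_dvd_iff LaurentPolynomial.invert, ← toLaurent_reverse_dvd_iff] at hmem
  simp only [map_add, map_mul, LaurentPolynomial.invert_T, neg_neg, invert_toLaurent ρ,
    LaurentPolynomial.involutive_invert (toLaurent μ)] at hmem
  apply dvd_of_toLaurent_dvd_toLaurent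
    (isCoprime_X_of_dvd_X_pow_sub_one hr (reverse_dvd_X_pow_sub_one hβr))
  have htotal := dvd_sub (dvd_add (hmem.mul_left
      (LaurentPolynomial.T ((ρ.natDegree : ℤ) + g.natDegree + β.natDegree)))
    ((dvd_sub hTm hTr).mul_left (toLaurent μ * toLaurent ρ.reverse)))
    ((dvd_sub hTm hTs).mul_left
      (LaurentPolynomial.T ((ρ.natDegree : ℤ) + g.natDegree - a.natDegree)))
  convert htotal using 1
  rw [natDegree_mul hg hρ]
  simp only [map_sub, map_mul, toLaurent_X_pow]
  have e1 : (LaurentPolynomial.T ((ρ.natDegree : ℤ) + g.natDegree + β.natDegree) *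
      LaurentPolynomial.T (-(ρ.natDegree : ℤ)) * LaurentPolynomial.T (bc.natDegree : ℤ) :
        LaurentPolynomial (ZMod 2)) = LaurentPolynomial.T r := by
    rw [← LaurentPolynomial.T_add, ← LaurentPolynomial.T_add]
    congr 1
    omega
  have e2 : (LaurentPolynomial.T ((ρ.natDegree : ℤ) + g.natDegree + β.natDegree) *
      LaurentPolynomial.T (k.natDegree : ℤ) : LaurentPolynomial (ZMod 2)) =
        LaurentPolynomial.T ((ρ.natDegree : ℤ) + g.natDegree - a.natDegree) *
          LaurentPolynomial.T s := by
    rw [← LaurentPolynomial.T_add, ← LaurentPolynomial.T_add]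
    congr 1
    omega
  have e3 : (LaurentPolynomial.T
        ((r * M - a.natDegree + (g.natDegree + ρ.natDegree) : ℕ) : ℤ) :
        LaurentPolynomial (ZMod 2)) =
      LaurentPolynomial.T ((ρ.natDegree : ℤ) + g.natDegree - a.natDegree) *
        LaurentPolynomial.T (r * M : ℕ) := by
    rw [← LaurentPolynomial.T_add]
    congr 1
    omega
  linear_combination -(toLaurent μ * toLaurent ρ.reverse) * e1 - e2 - e3 +
    LaurentPolynomial.T ((ρ.natDegree : ℤ) + g.natDegree - a.natDegree) *
      LaurentPolynomial.T s * LaurentPolynomial.zmod_two_neg_one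

/-- Let `C = ⟨(b | 0), (ℓ | a)⟩` be a non-separable `Z₂`-double cyclic code (with the
canonical conditions on the generators) and write `C^⊥ = ⟨(b̄ | 0), (ℓ̄ | ā)⟩` (with the
analogous canonical conditions). Let `ρ = ℓ/gcd(b, ℓ)` and `𝔪 = lcm(r, s)`. Then there is
`λ ∈ Z₂[x]` with `ℓ̄ = ((x^r−1)/b*)·λ` in `Z₂[x]/(x^r−1)` and
`λ·x^𝔪·ρ* ≡ x^{𝔪 − deg a + deg ℓ} (mod b*/gcd(b, ℓ)*)`; moreover `ρ*` is invertible
modulo `b*/gcd(b, ℓ)*` (so that `λ ≡ x^{𝔪 − deg a + deg ℓ}·(ρ*)⁻¹`). -/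
theorem stmt19 (r s : ℕ) (hr : 0 < r) (hs : 0 < s) (b l a bb ll aa : Z2P)
    (C : Submodule Z2P (Rq r × Rq s))
    (hCdef : C = Submodule.span Z2P {((mkQ r b, 0) : Rq r × Rq s), (mkQ r l, mkQ s a)})
    (hb : b ∣ (X : Z2P) ^ r - 1) (ha : a ∣ (X : Z2P) ^ s - 1)
    (hker : C ⊓ LinearMap.ker (LinearMap.snd Z2P (Rq r) (Rq s)) =
      Submodule.span Z2P {((mkQ r b, 0) : Rq r × Rq s)})
    (hCs : Submodule.map (LinearMap.snd Z2P (Rq r) (Rq s)) C =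
      Submodule.span Z2P {mkQ s a})
    (hnonsep : C ≠ Submodule.prod
      (Submodule.map (LinearMap.fst Z2P (Rq r) (Rq s)) C)
      (Submodule.map (LinearMap.snd Z2P (Rq r) (Rq s)) C))
    (hbb : bb ∣ (X : Z2P) ^ r - 1) (haa : aa ∣ (X : Z2P) ^ s - 1)
    (hdual : dualCode r s C =
      (Submodule.span Z2P {((mkQ r bb, 0) : Rq r × Rq s), (mkQ r ll, mkQ s aa)} :
        Set (Rq r × Rq s)))
    (hkerdual : {c : Rq r × Rq s | c ∈ dualCode r s C ∧ c.2 = 0} =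
      (Submodule.span Z2P {((mkQ r bb, 0) : Rq r × Rq s)} : Set (Rq r × Rq s)))
    (hCsdual : {q : Rq s | ∃ p : Rq r, (p, q) ∈ dualCode r s C} =
      (Submodule.span Z2P {mkQ s aa} : Set (Rq s))) :
    ∃ lam : Z2P,
      mkQ r ll = mkQ r ((((X : Z2P) ^ r - 1) / b.reverse) * lam) ∧
      (b.reverse / (gcd b l).reverse) ∣
        (lam * (X : Z2P) ^ (Nat.lcm r s) * (l / gcd b l).reverse -
          (X : Z2P) ^ (Nat.lcm r s - a.natDegree + l.natDegree)) ∧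
      IsUnit (Ideal.Quotient.mk (Ideal.span {b.reverse / (gcd b l).reverse})
        (l / gcd b l).reverse) := by
  have hr0 : (X : Z2P) ^ r - 1 ≠ 0 := (monic_X_pow_sub_C (1 : ZMod 2) hr.ne').ne_zero
  have hb0 : b ≠ 0 := ne_zero_of_dvd_ne_zero hr0 hb
  have hg0 : gcd b l ≠ 0 := fun h => hb0 ((gcd_eq_zero_iff b l).mp h).1
  have hcop : IsCoprime (b / gcd b l) (l / gcd b l) := by
    have := isCoprime_div_gcd_div_gcd (p := l) hb0
    rw [gcd_comm] at this
    exact this.symm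
  have hbβ : gcd b l * (b / gcd b l) = b := EuclideanDomain.mul_div_cancel' hg0 (gcd_dvd_left b l)
  have hlρ : gcd b l * (l / gcd b l) = l := EuclideanDomain.mul_div_cancel' hg0 (gcd_dvd_right b l)
  generalize gcd b l = g at *
  generalize b / g = β at *
  generalize l / g = ρ at *
  subst hbβ hlρ
  obtain ⟨bc, hbc⟩ := hb
  obtain ⟨ac, hac⟩ := ha
  have hβac : β ∣ ac := by
    have hmem : ((mkQ r (ac * (g * ρ)), 0) : Rq r × Rq s) ∈
        C ⊓ LinearMap.ker (LinearMap.snd Z2P (Rq r) (Rq s)) := by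
      refine ⟨?_, by simp⟩
      rw [hCdef]
      refine Submodule.mem_span_pair.mpr ⟨0, ac, ?_⟩
      have : mkQ s (ac * a) = 0 := mkQ_eq_zero_iff.mpr ⟨1, by rw [hac]; ring⟩
      simp only [zero_smul, zero_add, Prod.smul_mk, smul_mkQ, this]
    rw [hker] at hmem
    obtain ⟨f, hf⟩ := Submodule.mem_span_singleton.mp hmem
    have h1 : mkQ r (f * (g * β)) = mkQ r (ac * (g * ρ)) := congrArg Prod.fst hf
    have h2 : g * β ∣ f * (g * β) - ac * (g * ρ) :=
      (Dvd.intro _ hbc.symm).trans (mkQ_eq_mkQ_iff.mp h1)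
    have h3 : g * β ∣ g * (ac * ρ) := by
      rw [show g * (ac * ρ) = ac * (g * ρ) by ring]
      exact (dvd_sub_right (dvd_mul_left _ _)).mp h2
    exact hcop.dvd_of_dvd_mul_right ((mul_dvd_mul_iff_left hg0).mp h3)
  obtain ⟨k, rfl⟩ := hβac
  obtain ⟨M, hM⟩ := Nat.dvd_lcm_left r s
  obtain ⟨N, hN⟩ := Nat.dvd_lcm_right r s
  have hpos : 0 < r.lcm s := Nat.lcm_pos hr hs
  have hM0 : 0 < M := Nat.pos_of_ne_zero (by rintro rfl; simp [hM] at hpos)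
  have hN0 : 0 < N := Nat.pos_of_ne_zero (by rintro rfl; simp [hN] at hpos)
  have hMN : r * M = s * N := hM.symm.trans hN
  have hbcX : bc.reverse ∣ X ^ r - 1 := reverse_dvd_X_pow_sub_one ⟨g * β, by rw [hbc]; ring⟩
  have hmem : (mkQ r ll, mkQ s aa) ∈ dualCode r s C := by
    rw [hdual]
    exact Submodule.subset_span (by simp)
  -- The first component of an orthogonal pair is a multiple of `bc.reverse`.
  obtain ⟨lam, hlam⟩ : bc.reverse ∣ ll := by
    have h := hmem
    rw [hCdef, mkQ_pair_mem_dualCode_span_iff hr hs hM0 hN0 hMN, ← toLaurent_X_pow_sub_one, hbc,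
      map_mul] at h
    apply dvd_of_toLaurent_dvd_toLaurent (isCoprime_X_of_dvd_X_pow_sub_one hr hbcX)
    rw [toLaurent_reverse_dvd_iff, invert_dvd_iff]
    exact (mul_dvd_mul_iff_left (toLaurent_ne_zero.mpr hb0)).mp h.1
  have haak : aa = k.reverse := by
    have hkX : k.reverse ∣ X ^ s - 1 := reverse_dvd_X_pow_sub_one ⟨a * β, by rw [hac]; ring⟩
    apply zmod_two_eq_of_dvd_dvd
    · obtain ⟨p, j, hpj⟩ := exists_mkQ_X_pow_mul_reverse_mem_dualCode hr hs hM0 hN0 hMN hbc hac hcop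
      rw [← hCdef] at hpj
      have h1 : mkQ s (X ^ j * k.reverse) ∈ (Submodule.span Z2P {mkQ s aa} : Set (Rq s)) := by
        rw [← hCsdual]
        exact ⟨p, hpj⟩
      obtain ⟨f, hf⟩ := Submodule.mem_span_singleton.mp h1
      have h2 : aa ∣ f * aa - X ^ j * k.reverse := haa.trans (mkQ_eq_mkQ_iff.mp hf)
      exact ((isCoprime_X_of_dvd_X_pow_sub_one hs haa).pow_right).dvd_of_dvd_mul_left
        ((dvd_sub_right (dvd_mul_left _ _)).mp h2)
    · have h := hmem
      rw [hCdef, hlam, mkQ_reverse_mul_mem_dualCode_iff hr hs hM0 hN0 hMN hbc hac] at h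
      apply dvd_of_toLaurent_dvd_toLaurent (isCoprime_X_of_dvd_X_pow_sub_one hs hkX)
      rw [toLaurent_reverse_dvd_iff, invert_dvd_iff]
      exact (dvd_add_right (dvd_mul_right _ _)).mp ((dvd_mul_right _ _).trans h)
  have hbrev0 : (g * β).reverse ≠ 0 := by simpa using hb0
  have hdiv1 : ((X : Z2P) ^ r - 1) / (g * β).reverse = bc.reverse := by
    rw [← reverse_X_pow_sub_one, hbc, reverse_mul_of_domain (g * β),
      mul_div_cancel_left₀ _ hbrev0]
  have hdiv2 : (g * β).reverse / g.reverse = β.reverse := by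
    rw [reverse_mul_of_domain, mul_div_cancel_left₀ _ (by simpa using hg0)]
  have hβX : β.reverse ∣ X ^ r - 1 := reverse_dvd_X_pow_sub_one ⟨g * bc, by rw [hbc]; ring⟩
  have hcop' : IsCoprime β.reverse ρ.reverse :=
    isCoprime_reverse hcop (isCoprime_X_of_dvd_X_pow_sub_one hr hβX)
  rw [hdiv1, hdiv2, hM]
  refine ⟨lam, by rw [hlam], ?_, ?_⟩
  · by_cases hρ : ρ = 0
    · rw [hρ, reverse_zero, isCoprime_zero_right] at hcop'
      exact hcop'.dvd
    · rw [hlam, haak, hCdef] at hmem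
      exact reverse_dvd_of_mkQ_mem_dualCode hr hs hM0 hN0 hMN hg0 hρ hbc hac lam hmem
  · obtain ⟨c, d, hcd⟩ := hcop'
    refine IsUnit.of_mul_eq_one_right (Ideal.Quotient.mk _ d) ?_
    rw [← map_mul, ← map_one (Ideal.Quotient.mk _), Ideal.Quotient.eq, Ideal.mem_span_singleton]
    exact ⟨-c, by linear_combination hcd⟩
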